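/- For any probability measure ~ρ on ℝ, any ⊞-infinitely divisible probability measure τ, and any ~β ∈ ℝ, ~γ > 0, there exists a two-state free convolution semigroup {(~μ_t, μ_t) : t ≥ 0} such that ~μ_1 has mean ~β and variance ~γ and J[~μ_t] = ~ρ ⊞ τ^{⊞t} for all t > 0; one may take μ_t = (τ ⊳ ~ρ)^{⊞t} and ~μ_t defined by z − F_{~μ_t}(z) = ~β t + ~γ t·G_{~ρ ⊞ τ^{⊞t}}(z). -/

import Mathlib

open MeasureTheory Complex

noncomputable section

/-- The Cauchy transform `G_μ(z) = ∫ 1/(z - x) dμ(x)` of a measure on `ℝ`. -/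
def cauchyG (μ : Measure ℝ) (z : ℂ) : ℂ := ∫ x : ℝ, (z - (x : ℂ))⁻¹ ∂μ

/-- The F-transform `F_μ = 1/G_μ`. -/
def Ftr (μ : Measure ℝ) (z : ℂ) : ℂ := (cauchyG μ z)⁻¹

/-- The open upper half-plane `ℂ⁺`. -/
def UHP : Set ℂ := {z : ℂ | 0 < z.im}

/-- The truncated cone `Γ_{α,M} = {z ∈ ℂ⁺ : |Re z| < α · Im z, Im z > M}`. -/
def tcone (α M : ℝ) : Set ℂ := {z : ℂ | |z.re| < α * z.im ∧ M < z.im}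

/-- `φ` is a Voiculescu transform of `μ`: `φ(F_μ(z)) + F_μ(z) = z` on some truncated cone. -/
def IsVT (μ : Measure ℝ) (φ : ℂ → ℂ) : Prop :=
  ∃ α M : ℝ, 0 < α ∧ 0 < M ∧ ∀ z ∈ tcone α M, φ (Ftr μ z) + Ftr μ z = z

/-- `ψ` is a two-state Voiculescu transform of the pair `(μt, μ)`:
`ψ(F_μ(z)) + F_{μt}(z) = z` on some truncated cone. -/
def IsTwoStateVT (μt μ : Measure ℝ) (ψ : ℂ → ℂ) : Prop :=
  ∃ α M : ℝ, 0 < α ∧ 0 < M ∧ ∀ z ∈ tcone α M, ψ (Ftr μ z) + Ftr μt z = z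

/-- `μ` is freely infinitely divisible: some Voiculescu transform `φ` of `μ` is such that
`t·φ` is a Voiculescu transform of a probability measure for every `t ≥ 0`. -/
def IsFID (μ : Measure ℝ) : Prop :=
  ∃ φ : ℂ → ℂ, IsVT μ φ ∧ ∀ t : ℝ, 0 ≤ t →
    ∃ ν : Measure ℝ, IsProbabilityMeasure ν ∧ IsVT ν (fun z => (t : ℂ) * φ z)

/-- The semicircular distribution with mean `β` and variance `γ` (Dirac mass at `β` for `γ = 0`). -/
def semicircle (β γ : ℝ) : Measure ℝ :=
  if γ = 0 then Measure.dirac β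
  else volume.withDensity
    (fun x => ENNReal.ofReal ((2 * Real.pi * γ)⁻¹ * Real.sqrt (4 * γ - (x - β) ^ 2)))

section FreeConvolution

open Filter Topology Set

open scoped ComplexConjugate

lemma mem_UHP {z : ℂ} : z ∈ UHP ↔ 0 < z.im := Iff.rfl

lemma isOpen_UHP : IsOpen UHP := isOpen_lt continuous_const continuous_im

section CauchyTransform

variable {μ : Measure ℝ} {z : ℂ}

lemma sub_ofReal_ne_zero (hz : z ∈ UHP) (x : ℝ) : z - x ≠ 0 := by
  intro h
  have := congrArg im h
  simp only [sub_im, ofReal_im, sub_zero, zero_im] at this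
  exact (mem_UHP.1 hz).ne' this

lemma norm_inv_sub_ofReal_le (hz : z ∈ UHP) (x : ℝ) : ‖(z - x)⁻¹‖ ≤ z.im⁻¹ := by
  rw [norm_inv]
  refine inv_anti₀ hz ?_
  simpa [abs_of_pos (mem_UHP.1 hz)] using abs_im_le_norm (z - x)

lemma aestronglyMeasurable_inv_sub : AEStronglyMeasurable (fun x : ℝ => (z - x)⁻¹) μ :=
  Measurable.aestronglyMeasurable (by fun_prop)

lemma integrable_inv_sub [IsFiniteMeasure μ] (hz : z ∈ UHP) :
    Integrable (fun x : ℝ => (z - x)⁻¹) μ :=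
  Integrable.of_bound aestronglyMeasurable_inv_sub z.im⁻¹
    (ae_of_all _ fun x => norm_inv_sub_ofReal_le hz x)

lemma integrable_norm_inv_sub_sq [IsFiniteMeasure μ] (hz : z ∈ UHP) :
    Integrable (fun x : ℝ => ‖(z - x)⁻¹‖ ^ 2) μ := by
  refine Integrable.of_bound (Measurable.aestronglyMeasurable (by fun_prop)) (z.im⁻¹ ^ 2)
    (ae_of_all _ fun x => ?_)
  rw [norm_pow, norm_norm]
  gcongr
  exact norm_inv_sub_ofReal_le hz x

lemma im_inv_sub_ofReal (x : ℝ) : ((z - x)⁻¹).im = -(z.im * ‖(z - x)⁻¹‖ ^ 2) := by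
  rw [inv_im, norm_inv, inv_pow, ← normSq_eq_norm_sq]
  simp [div_eq_mul_inv]

lemma im_cauchyG [IsFiniteMeasure μ] (hz : z ∈ UHP) :
    (cauchyG μ z).im = -(z.im * ∫ x : ℝ, ‖(z - x)⁻¹‖ ^ 2 ∂μ) := by
  rw [cauchyG, ← integral_const_mul, ← integral_neg]
  refine (imCLM.integral_comp_comm (integrable_inv_sub hz)).symm.trans ?_
  exact integral_congr_ae (ae_of_all _ fun x => im_inv_sub_ofReal x)

lemma norm_cauchyG_le [IsProbabilityMeasure μ] (hz : z ∈ UHP) : ‖cauchyG μ z‖ ≤ z.im⁻¹ := by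
  simpa [cauchyG] using norm_integral_le_of_norm_le_const (μ := μ)
    (ae_of_all _ fun x => norm_inv_sub_ofReal_le hz x)

lemma norm_cauchyG_sq_le [IsProbabilityMeasure μ] (hz : z ∈ UHP) :
    ‖cauchyG μ z‖ ^ 2 ≤ ∫ x : ℝ, ‖(z - x)⁻¹‖ ^ 2 ∂μ := by
  have hn := (integrable_inv_sub (μ := μ) hz).norm
  have h1 : ‖cauchyG μ z‖ ≤ ∫ x : ℝ, ‖(z - x)⁻¹‖ ∂μ := norm_integral_le_integral_norm _
  have h2 : 0 ≤ ∫ x : ℝ, (‖(z - x)⁻¹‖ - ‖cauchyG μ z‖) ^ 2 ∂μ :=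
    integral_nonneg fun x => sq_nonneg _
  have h3 : ∫ x : ℝ, (‖(z - x)⁻¹‖ - ‖cauchyG μ z‖) ^ 2 ∂μ =
      (∫ x : ℝ, ‖(z - x)⁻¹‖ ^ 2 ∂μ) - 2 * ‖cauchyG μ z‖ * (∫ x : ℝ, ‖(z - x)⁻¹‖ ∂μ)
        + ‖cauchyG μ z‖ ^ 2 := by
    rw [← integral_const_mul, ← integral_sub (integrable_norm_inv_sub_sq hz) (hn.const_mul _)]
    have : ‖cauchyG μ z‖ ^ 2 = ∫ _ : ℝ, ‖cauchyG μ z‖ ^ 2 ∂μ := by simp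
    have hs : Integrable (fun x : ℝ => ‖(z - x)⁻¹‖ ^ 2 - 2 * ‖cauchyG μ z‖ * ‖(z - x)⁻¹‖) μ :=
      (integrable_norm_inv_sub_sq hz).sub (hn.const_mul _)
    rw [this, ← integral_add hs (integrable_const _)]
    exact integral_congr_ae (ae_of_all _ fun x => by ring)
  nlinarith [norm_nonneg (cauchyG μ z)]

lemma integral_norm_inv_sub_sq_pos [IsProbabilityMeasure μ] (hz : z ∈ UHP) :
    0 < ∫ x : ℝ, ‖(z - x)⁻¹‖ ^ 2 ∂μ := by
  rw [integral_pos_iff_support_of_nonneg (fun x => by positivity) (integrable_norm_inv_sub_sq hz)]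
  have : Function.support (fun x : ℝ => ‖(z - x)⁻¹‖ ^ 2) = univ := by
    ext x
    simpa using sub_ofReal_ne_zero hz x
  rw [this, measure_univ]
  exact one_pos

lemma im_cauchyG_neg [IsProbabilityMeasure μ] (hz : z ∈ UHP) : (cauchyG μ z).im < 0 := by
  rw [im_cauchyG hz, neg_lt_zero]
  exact mul_pos hz (integral_norm_inv_sub_sq_pos hz)

lemma cauchyG_ne_zero [IsProbabilityMeasure μ] (hz : z ∈ UHP) : cauchyG μ z ≠ 0 := by
  intro h
  simpa [h] using im_cauchyG_neg (μ := μ) hz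

lemma differentiableOn_cauchyG (μ : Measure ℝ) [IsFiniteMeasure μ] :
    DifferentiableOn ℂ (cauchyG μ) UHP := by
  have h : ∀ z, cauchyG μ z = -resolventTransform μ z := fun z => by
    rw [cauchyG, resolventTransform_apply, ← integral_neg]
    refine integral_congr_ae (ae_of_all _ fun x => ?_)
    simp [resolvent, ← inv_neg]
  intro z hz
  have hz' : z ∉ algebraMap ℝ ℂ '' μ.support := by
    rintro ⟨x, -, rfl⟩
    simp [UHP] at hz
  rw [funext h]
  exact (hasDerivAt_resolventTransform z hz').differentiableAt.differentiableWithinAt.neg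

lemma im_le_im_Ftr [IsProbabilityMeasure μ] (hz : z ∈ UHP) : z.im ≤ (Ftr μ z).im := by
  have hG := cauchyG_ne_zero (μ := μ) hz
  rw [Ftr, inv_im, le_div_iff₀ (normSq_pos.2 hG), im_cauchyG hz, neg_neg, normSq_eq_norm_sq]
  exact mul_le_mul_of_nonneg_left (norm_cauchyG_sq_le hz) (le_of_lt hz)

lemma Ftr_mem_UHP [IsProbabilityMeasure μ] (hz : z ∈ UHP) : Ftr μ z ∈ UHP :=
  lt_of_lt_of_le hz (im_le_im_Ftr hz)

lemma differentiableOn_Ftr (μ : Measure ℝ) [IsProbabilityMeasure μ] :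
    DifferentiableOn ℂ (Ftr μ) UHP :=
  (differentiableOn_cauchyG μ).inv fun _ hz => cauchyG_ne_zero hz

end CauchyTransform

section Nontangential

/-- The filter of neighbourhoods of infinity in the cone `|Re z| < α · Im z`. -/
def coneAtTop (α : ℝ) : Filter ℂ := comap im atTop ⊓ 𝓟 {z | |z.re| < α * z.im}

instance (α : ℝ) : (coneAtTop α).IsCountablyGenerated := by
  unfold coneAtTop; infer_instance

lemma eventually_coneAtTop {α : ℝ} {p : ℂ → Prop} :
    (∀ᶠ z in coneAtTop α, p z) ↔ ∃ M, 0 < M ∧ ∀ z ∈ tcone α M, p z := by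
  have hb : ((atTop : Filter ℝ).HasBasis (fun M : ℝ => 0 < M) Ioi) := atTop_basis_Ioi' 0
  rw [coneAtTop, ((hb.comap im).inf_principal _).eventually_iff]
  refine exists_congr fun M => and_congr_right fun _ => ?_
  simp [tcone, and_comm]

lemma tendsto_norm_coneAtTop (α : ℝ) : Tendsto (fun z : ℂ => ‖z‖) (coneAtTop α) atTop :=
  tendsto_atTop_mono im_le_norm (tendsto_comap.mono_left inf_le_left)

lemma eventually_im_pos_coneAtTop (α : ℝ) : ∀ᶠ z in coneAtTop α, z ∈ UHP :=
  (tendsto_comap.mono_left inf_le_left : Tendsto im (coneAtTop α) atTop).eventually_gt_atTop 0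

lemma eventually_cone_coneAtTop (α : ℝ) : ∀ᶠ z in coneAtTop α, |z.re| < α * z.im :=
  mem_inf_of_right (mem_principal_self _)

lemma tendsto_ofReal_mul_I_coneAtTop {α : ℝ} (hα : 0 < α) :
    Tendsto (fun y : ℝ => (y : ℂ) * I) atTop (coneAtTop α) := by
  refine tendsto_inf.2 ⟨tendsto_comap_iff.2 ?_, tendsto_principal.2 ?_⟩
  · have : (im ∘ fun y : ℝ => (y : ℂ) * I) = id := by ext; simp
    rw [this]
    exact tendsto_id
  · filter_upwards [eventually_gt_atTop 0] with y hy
    simp [hα, hy]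

lemma tendsto_mul_cauchyG (μ : Measure ℝ) [IsProbabilityMeasure μ] (α : ℝ) :
    Tendsto (fun z => z * cauchyG μ z) (coneAtTop α) (𝓝 1) := by
  have h1 : ∀ z, z * cauchyG μ z = ∫ x : ℝ, z * (z - x)⁻¹ ∂μ := fun z => by
    rw [cauchyG, integral_const_mul]
  have h2 : (1 : ℂ) = ∫ _ : ℝ, 1 ∂μ := by simp
  rw [funext h1, h2]
  refine tendsto_integral_filter_of_dominated_convergence (fun _ => |α| + 1)
    (.of_forall fun z => Measurable.aestronglyMeasurable (by fun_prop)) ?_ (integrable_const _)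
    (ae_of_all _ fun x => ?_)
  · filter_upwards [eventually_im_pos_coneAtTop α, eventually_cone_coneAtTop α] with z hz hc
    refine ae_of_all _ fun x => ?_
    have hz0 : 0 < z.im := hz
    calc ‖z * (z - x)⁻¹‖ ≤ (|z.re| + |z.im|) * z.im⁻¹ := by
          rw [norm_mul]
          exact mul_le_mul (norm_le_abs_re_add_abs_im z) (norm_inv_sub_ofReal_le hz x)
            (norm_nonneg _) (by positivity)
      _ ≤ (|α| * z.im + z.im) * z.im⁻¹ := by
          rw [abs_of_pos hz0]
          have := mul_le_mul_of_nonneg_right (le_abs_self α) hz0.le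
          gcongr
          linarith
      _ = |α| + 1 := by field_simp
  · have h3 : Tendsto (fun z : ℂ => (1 - x * z⁻¹)⁻¹) (coneAtTop α) (𝓝 ((1 - x * 0)⁻¹)) := by
      have : Tendsto (fun z : ℂ => z⁻¹) (coneAtTop α) (𝓝 0) :=
        tendsto_inv₀_cobounded.comp (tendsto_norm_atTop_iff_cobounded.1 (tendsto_norm_coneAtTop α))
      exact (tendsto_const_nhds.sub (tendsto_const_nhds.mul this)).inv₀ (by simp)
    rw [mul_zero, sub_zero, inv_one] at h3
    refine h3.congr' ?_
    filter_upwards [eventually_im_pos_coneAtTop α] with z hz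
    have hz0 : z ≠ 0 := by simpa using sub_ofReal_ne_zero hz 0
    have := sub_ofReal_ne_zero hz x
    have e : 1 - (x : ℂ) * z⁻¹ = (z - x) / z := by field_simp
    rw [e, inv_div, div_eq_mul_inv]

lemma tendsto_cauchyG (μ : Measure ℝ) [IsProbabilityMeasure μ] (α : ℝ) :
    Tendsto (cauchyG μ) (coneAtTop α) (𝓝 0) := by
  have h : Tendsto (fun z : ℂ => z.im⁻¹) (coneAtTop α) (𝓝 0) :=
    tendsto_inv_atTop_zero.comp (tendsto_comap.mono_left inf_le_left)
  refine squeeze_zero_norm' ?_ h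
  filter_upwards [eventually_im_pos_coneAtTop α] with z hz using norm_cauchyG_le hz

lemma tendsto_Ftr_div (μ : Measure ℝ) [IsProbabilityMeasure μ] (α : ℝ) :
    Tendsto (fun z => Ftr μ z / z) (coneAtTop α) (𝓝 1) := by
  have := (tendsto_mul_cauchyG μ α).inv₀ one_ne_zero
  rw [inv_one] at this
  refine this.congr fun z => ?_
  rw [mul_inv, Ftr, mul_comm, div_eq_mul_inv]

lemma exists_norm_Ftr_sub_le (μ : Measure ℝ) [IsProbabilityMeasure μ] (α : ℝ) {ε : ℝ}
    (hε : 0 < ε) : ∃ M, 0 < M ∧ ∀ z ∈ tcone α M, ‖Ftr μ z - z‖ ≤ ε * ‖z‖ := by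
  rw [← eventually_coneAtTop]
  filter_upwards [Metric.tendsto_nhds.1 (tendsto_Ftr_div μ α) ε hε,
    eventually_im_pos_coneAtTop α] with z h hz
  have hz0 : z ≠ 0 := by simpa using sub_ofReal_ne_zero hz 0
  have e : Ftr μ z - z = (Ftr μ z / z - 1) * z := by field_simp
  rw [e, norm_mul]
  rw [dist_eq_norm] at h
  gcongr

end Nontangential

section Herglotz

open Metric InnerProductSpace Real

/-- The boundary measure of a nonnegative continuous density on the unit circle. -/
lemma exists_finiteMeasure_integral_eq_circleAverage {h : ℂ → ℝ} (hc : ContinuousOn h (sphere 0 1))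
    (h0 : ∀ ζ ∈ sphere (0 : ℂ) 1, 0 ≤ h ζ) :
    ∃ σ : FiniteMeasure (sphere (0 : ℂ) 1), ∀ f : ℂ → ℝ, ContinuousOn f (sphere 0 1) →
      ∫ ζ : sphere (0 : ℂ) 1, f ζ ∂(σ : Measure (sphere (0 : ℂ) 1)) =
        circleAverage (fun ζ => f ζ * h ζ) 0 1 := by
  have hmem : ∀ θ : ℝ, circleMap 0 1 θ ∈ sphere (0 : ℂ) 1 := fun θ => by simp
  let e : ℝ → sphere (0 : ℂ) 1 := fun θ => ⟨circleMap 0 1 θ, hmem θ⟩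
  have he : Continuous e := (continuous_circleMap 0 1).subtype_mk _
  have hcirc : ∀ {g : ℂ → ℝ}, ContinuousOn g (sphere 0 1) →
      Continuous fun θ : ℝ => g (circleMap 0 1 θ) := fun hg =>
    hg.comp_continuous (continuous_circleMap 0 1) hmem
  have hd : Measurable fun θ : ℝ => ENNReal.ofReal ((2 * π)⁻¹ * h (circleMap 0 1 θ)) :=
    ((hcirc hc).measurable.const_mul _).ennreal_ofReal
  have hint : Integrable (fun θ : ℝ => (2 * π)⁻¹ * h (circleMap 0 1 θ))
      (volume.restrict (Ioc 0 (2 * π))) :=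
    (((hcirc hc).const_mul _).integrableOn_Icc (a := 0) (b := 2 * π)).mono_set Ioc_subset_Icc_self
  have hfin := isFiniteMeasure_withDensity_ofReal hint.hasFiniteIntegral
  refine ⟨⟨((volume.restrict (Ioc 0 (2 * π))).withDensity
    fun θ => ENNReal.ofReal ((2 * π)⁻¹ * h (circleMap 0 1 θ))).map e, inferInstance⟩,
    fun f hf => ?_⟩
  have hf' : Continuous fun ζ : sphere (0 : ℂ) 1 => f ζ := hf.domRestrict
  rw [FiniteMeasure.toMeasure_mk, integral_map he.aemeasurable hf'.aestronglyMeasurable,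
    integral_withDensity_eq_integral_toReal_smul hd (ae_of_all _ fun _ => ENNReal.ofReal_lt_top),
    circleAverage_def, intervalIntegral.integral_of_le (by positivity), ← integral_smul]
  refine integral_congr_ae (ae_of_all _ fun θ => ?_)
  have : 0 ≤ (2 * π)⁻¹ * h (circleMap 0 1 θ) := mul_nonneg (by positivity) (h0 _ (hmem θ))
  simp only [ENNReal.toReal_ofReal this, smul_eq_mul, e]
  ring

lemma continuousOn_poissonKernel {u : ℂ} (hu : u ∈ ball (0 : ℂ) 1) :
    ContinuousOn (poissonKernel 0 u) (sphere 0 1) := by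
  unfold poissonKernel
  refine ContinuousOn.div (by fun_prop) (by fun_prop) fun ζ hζ h => ?_
  have : ζ = u := by simpa [sub_eq_zero] using h
  subst this
  simp_all

/-- **Herglotz representation**: a function with nonnegative real part on the unit disc is, up to
an imaginary constant, the Poisson integral of a finite measure on the circle. -/
theorem exists_finiteMeasure_poissonKernel_eq_re {P : ℂ → ℂ}
    (hP : DifferentiableOn ℂ P (ball 0 1)) (hre : ∀ u ∈ ball (0 : ℂ) 1, 0 ≤ (P u).re) :
    ∃ σ : FiniteMeasure (sphere (0 : ℂ) 1), ∀ u ∈ ball (0 : ℂ) 1,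
      ∫ ζ : sphere (0 : ℂ) 1, poissonKernel 0 u ζ ∂(σ : Measure (sphere (0 : ℂ) 1)) =
        (P u).re := by
  have hr : ∀ n : ℕ, ∃ r : ℝ, 0 ≤ r ∧ r < 1 ∧ r = 1 - 1 / ((n : ℝ) + 1) := fun n => by
    have h1 : 0 < 1 / ((n : ℝ) + 1) := by positivity
    have h2 : 1 / ((n : ℝ) + 1) ≤ 1 := by
      rw [div_le_one (by positivity)]
      linarith [(Nat.cast_nonneg n : (0 : ℝ) ≤ n)]
    exact ⟨_, by linarith, by linarith, rfl⟩
  choose r hr0 hr1 hrn using hr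
  have hrlim : Tendsto r atTop (𝓝 1) := by
    rw [funext hrn]
    simpa using tendsto_const_nhds.sub (tendsto_one_div_add_atTop_nhds_zero_nat (𝕜 := ℝ))
  have hmem : ∀ n, ∀ ζ ∈ closedBall (0 : ℂ) 1, (r n : ℂ) * ζ ∈ ball (0 : ℂ) 1 := fun n ζ hζ => by
    rw [mem_closedBall_zero_iff] at hζ
    rw [mem_ball_zero_iff, norm_mul, norm_real, Real.norm_of_nonneg (hr0 n)]
    nlinarith [hr0 n, hr1 n]
  have hharm : ∀ n, HarmonicOnNhd (fun ζ => (P (r n * ζ)).re) (closedBall 0 1) := fun n ζ hζ => by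
    have h1 : AnalyticAt ℂ P (r n * ζ) := hP.analyticAt (isOpen_ball.mem_nhds (hmem n ζ hζ))
    have h2 : AnalyticAt ℂ (fun ζ => (r n : ℂ) * ζ) ζ := by fun_prop
    exact (h1.fun_comp h2).harmonicAt_re
  have hcont : ∀ n, ContinuousOn (fun ζ => (P (r n * ζ)).re) (sphere 0 1) := fun n => by
    refine continuous_re.comp_continuousOn (hP.continuousOn.comp (by fun_prop) fun ζ hζ => ?_)
    exact hmem n ζ (sphere_subset_closedBall hζ)
  choose σ hσ using fun n => exists_finiteMeasure_integral_eq_circleAverage (hcont n)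
    fun ζ hζ => hre _ (hmem n ζ (sphere_subset_closedBall hζ))
  have hσP : ∀ n, ∀ u ∈ ball (0 : ℂ) 1, ∫ ζ : sphere (0 : ℂ) 1, poissonKernel 0 u ζ ∂(σ n : Measure
      (sphere (0 : ℂ) 1)) = (P (r n * u)).re := fun n u hu => by
    rw [hσ n _ (continuousOn_poissonKernel hu)]
    exact (hharm n).circleAverage_poissonKernel_smul hu
  have hmass : ∀ n, (σ n).mass = ⟨(P 0).re, hre 0 (by simp)⟩ := fun n => by
    have h := hσP n 0 (by simp)
    have h1 : ∀ ζ : sphere (0 : ℂ) 1, poissonKernel 0 0 (ζ : ℂ) = 1 := fun ζ => by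
      simp [poissonKernel_def]
    simp only [h1, mul_zero, integral_const, smul_eq_mul, mul_one] at h
    exact NNReal.eq h
  have hK := isCompact_setOfPred_finiteMeasure_eq_of_compactSpace (sphere (0 : ℂ) 1)
    ⟨(P 0).re, hre 0 (by simp)⟩
  obtain ⟨s, -, hs⟩ := hK.ultrafilter_le_nhds ((hyperfilter ℕ).map σ) (by
    rw [le_principal_iff]
    exact Ultrafilter.mem_map.2 (univ_mem' hmass))
  refine ⟨s, fun u hu => ?_⟩
  let f : BoundedContinuousFunction (sphere (0 : ℂ) 1) ℝ :=
    .mkOfCompact ⟨fun ζ => poissonKernel 0 u ζ, (continuousOn_poissonKernel hu).domRestrict⟩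
  have h1 := FiniteMeasure.tendsto_iff_forall_integral_tendsto.1
    (show Tendsto σ (hyperfilter ℕ) (𝓝 s) from hs) f
  have h2 : Tendsto (fun n => (P (r n * u)).re) atTop (𝓝 (P u).re) := by
    have h3 : Tendsto (fun n => (r n : ℂ) * u) atTop (𝓝 u) := by
      simpa using ((continuous_ofReal.tendsto 1).comp hrlim).mul_const u
    exact (continuous_re.tendsto _).comp
      ((hP.continuousOn.continuousAt (isOpen_ball.mem_nhds hu)).tendsto.comp h3)
  refine tendsto_nhds_unique h1 ?_
  refine Tendsto.congr (fun n => (hσP n u hu).symm) (h2.mono_left ?_)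
  exact Nat.hyperfilter_le_atTop

end Herglotz

section Cayley

/-- The inverse Cayley transform, mapping the unit disc onto the upper half-plane. -/
def invCayley (u : ℂ) : ℂ := I * (1 + u) / (1 - u)

lemma im_invCayley (u : ℂ) : (invCayley u).im = (1 - ‖u‖ ^ 2) / ‖1 - u‖ ^ 2 := by
  rw [invCayley, div_im, ← normSq_eq_norm_sq, ← normSq_eq_norm_sq, normSq_apply u]
  simp
  ring

lemma invCayley_mem_UHP {u : ℂ} (hu : u ∈ Metric.ball (0 : ℂ) 1) : invCayley u ∈ UHP := by
  rw [mem_ball_zero_iff] at hu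
  have h1 : (1 : ℂ) - u ≠ 0 := fun h => by
    rw [← sub_eq_zero.1 h, norm_one] at hu
    exact lt_irrefl _ hu
  rw [mem_UHP, im_invCayley]
  have : 0 < ‖1 - u‖ := norm_pos_iff.2 h1
  have : 0 < 1 - ‖u‖ ^ 2 := by nlinarith [norm_nonneg u]
  positivity

lemma differentiableOn_invCayley : DifferentiableOn ℂ invCayley (Metric.ball 0 1) := by
  unfold invCayley
  refine DifferentiableOn.div (by fun_prop) (by fun_prop) fun u hu h => ?_
  rw [← sub_eq_zero.1 h, mem_ball_zero_iff, norm_one] at hu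
  exact lt_irrefl _ hu

lemma add_I_ne_zero {z : ℂ} (hz : z ∈ UHP) : z + I ≠ 0 := fun h => by
  have := congrArg im h
  simp only [add_im, I_im, zero_im] at this
  linarith [mem_UHP.1 hz]

lemma norm_add_I_sq_sub (z : ℂ) : ‖z + I‖ ^ 2 - ‖z - I‖ ^ 2 = 4 * z.im := by
  rw [← normSq_eq_norm_sq, ← normSq_eq_norm_sq, normSq_apply, normSq_apply]
  simp
  ring

lemma one_sub_norm_cayley_sq {z : ℂ} (hz : z ∈ UHP) :
    1 - ‖(z - I) / (z + I)‖ ^ 2 = 4 * z.im / ‖z + I‖ ^ 2 := by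
  have : ‖z + I‖ ≠ 0 := norm_ne_zero_iff.2 (add_I_ne_zero hz)
  rw [← norm_add_I_sq_sub, norm_div]
  field_simp

lemma cayley_mem_ball {z : ℂ} (hz : z ∈ UHP) : (z - I) / (z + I) ∈ Metric.ball (0 : ℂ) 1 := by
  have h1 : 0 < ‖z + I‖ := norm_pos_iff.2 (add_I_ne_zero hz)
  have h2 := one_sub_norm_cayley_sq hz
  have h3 : 0 < 4 * z.im / ‖z + I‖ ^ 2 := by have := mem_UHP.1 hz; positivity
  rw [mem_ball_zero_iff]
  nlinarith [norm_nonneg ((z - I) / (z + I))]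

lemma invCayley_cayley {z : ℂ} (hz : z ∈ UHP) : invCayley ((z - I) / (z + I)) = z := by
  have h1 := add_I_ne_zero hz
  have h2 : (1 : ℂ) - (z - I) / (z + I) = 2 * I / (z + I) := by field_simp; ring
  rw [invCayley, h2]
  field_simp
  ring

lemma poissonKernel_cayley_one {z : ℂ} (hz : z ∈ UHP) :
    poissonKernel 0 ((z - I) / (z + I)) 1 = z.im := by
  have h1 := add_I_ne_zero hz
  have h0 : ‖z + I‖ ≠ 0 := norm_ne_zero_iff.2 h1
  have h2 : (1 : ℂ) - (z - I) / (z + I) = 2 * I / (z + I) := by field_simp; ring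
  rw [poissonKernel_def, sub_zero, sub_zero, norm_one, one_pow, one_sub_norm_cayley_sq hz, h2]
  simp only [norm_div, norm_mul, norm_I, Complex.norm_ofNat]
  field_simp
  ring

lemma poissonKernel_cayley {z ζ : ℂ} (hz : z ∈ UHP) (hζ : ‖ζ‖ = 1) (hζ1 : ζ ≠ 1) :
    poissonKernel 0 ((z - I) / (z + I)) ζ =
      z.im * ((1 + (invCayley ζ).re ^ 2) * ‖(z - (invCayley ζ).re)⁻¹‖ ^ 2) := by
  have h1 := add_I_ne_zero hz
  set x : ℝ := (invCayley ζ).re with hx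
  have him : (invCayley ζ).im = 0 := by rw [im_invCayley, hζ]; simp
  have hxc : invCayley ζ = x := Complex.ext (by simp [hx]) (by simp [him])
  have hxI : (x : ℂ) + I ≠ 0 := fun h => by simpa using congrArg im h
  have hζx : ζ = (x - I) / (x + I) := by
    have h2 : (1 : ℂ) - ζ ≠ 0 := sub_ne_zero.2 hζ1.symm
    have h3 : I * (1 + ζ) = x * (1 - ζ) := by
      rw [← hxc, invCayley]; field_simp
    rw [eq_div_iff hxI]
    linear_combination h3
  have hzx := sub_ofReal_ne_zero hz x
  have hdiff : ζ - (z - I) / (z + I) = -(2 * I * (z - x)) / ((x + I) * (z + I)) := by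
    rw [hζx]; field_simp; ring
  have hnx : ‖(x : ℂ) + I‖ ^ 2 = 1 + x ^ 2 := by
    rw [← normSq_eq_norm_sq, normSq_apply]; simp; ring
  have h0 : ‖z + I‖ ≠ 0 := norm_ne_zero_iff.2 h1
  have h0' : ‖z - x‖ ≠ 0 := norm_ne_zero_iff.2 hzx
  rw [poissonKernel_def, sub_zero, sub_zero, hζ, one_pow, one_sub_norm_cayley_sq hz, hdiff,
    ← hnx, norm_inv]
  simp only [norm_div, norm_neg, norm_mul, norm_I, Complex.norm_ofNat]
  have h0'' : ‖(x : ℂ) + I‖ ≠ 0 := norm_ne_zero_iff.2 hxI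
  field_simp
  ring

end Cayley

section Nevanlinna

lemma ofReal_mul_I_mem_UHP {y : ℝ} (hy : 0 < y) : (y : ℂ) * I ∈ UHP := by
  simpa [UHP] using hy

/-- A holomorphic function on the upper half-plane with zero imaginary part is constant. -/
lemma exists_eqOn_const_of_im_eq_zero {f : ℂ → ℂ} (hf : DifferentiableOn ℂ f UHP)
    (him : ∀ z ∈ UHP, (f z).im = 0) : ∃ w, ∀ z ∈ UHP, f z = w := by
  have hconv : Convex ℝ UHP := convex_halfSpace_im_gt 0
  rcases (hf.analyticOnNhd isOpen_UHP).is_constant_or_isOpen hconv.isPreconnected with h | h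
  · exact h
  have ho := h UHP subset_rfl isOpen_UHP
  have hI : I ∈ UHP := by simp [UHP]
  obtain ⟨ε, hε, hb⟩ := Metric.isOpen_iff.1 ho _ (mem_image_of_mem f hI)
  have hmem : f I + (ε / 2 : ℝ) * I ∈ Metric.ball (f I) ε := by
    rw [Metric.mem_ball, dist_eq_norm, add_sub_cancel_left, norm_mul, norm_real, norm_I, mul_one,
      Real.norm_of_nonneg (by positivity)]
    linarith
  obtain ⟨z, hz, hzf⟩ := hb hmem
  have := congrArg im hzf
  rw [him z hz, add_im, him I hI] at this
  simp at this
  linarith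

lemma tendsto_atTop_ofReal_inv : Tendsto (fun y : ℝ => ((y : ℂ) * I)⁻¹) atTop (𝓝 0) := by
  refine squeeze_zero_norm' ?_ tendsto_inv_atTop_zero
  filter_upwards [eventually_gt_atTop 0] with y hy
  rw [norm_inv, norm_mul, norm_I, mul_one, norm_real, Real.norm_of_nonneg (le_of_lt hy)]

/-- The function `y ↦ y² (1 + x²) / (y² + x²)` of the Nevanlinna representation on `iℝ`. -/
lemma mul_im_mul_norm_inv_sq (y x : ℝ) :
    y * (((y : ℂ) * I).im * ((1 + x ^ 2) * ‖((y : ℂ) * I - x)⁻¹‖ ^ 2)) =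
      (1 + x ^ 2) * (y ^ 2 / (y ^ 2 + x ^ 2)) := by
  have : ‖(y : ℂ) * I - x‖ ^ 2 = y ^ 2 + x ^ 2 := by
    rw [← normSq_eq_norm_sq, normSq_apply]; simp; ring
  rw [norm_inv, inv_pow, this]
  simp
  ring

lemma sq_div_sq_add_mono {y y' : ℝ} (hy : 0 < y) (h : y ≤ y') (x : ℝ) :
    y ^ 2 / (y ^ 2 + x ^ 2) ≤ y' ^ 2 / (y' ^ 2 + x ^ 2) := by
  have hy' : 0 < y' := hy.trans_le h
  have : y ^ 2 ≤ y' ^ 2 := by gcongr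
  rw [div_le_div_iff₀ (by positivity) (by positivity)]
  nlinarith [mul_le_mul_of_nonneg_right this (sq_nonneg x)]

lemma tendsto_sq_div_sq_add (x : ℝ) :
    Tendsto (fun y : ℝ => y ^ 2 / (y ^ 2 + x ^ 2)) atTop (𝓝 1) := by
  have h1 : Tendsto (fun y : ℝ => y ^ 2) atTop atTop := tendsto_pow_atTop two_ne_zero
  have h2 : Tendsto (fun y : ℝ => 1 - x ^ 2 * (y ^ 2 + x ^ 2)⁻¹) atTop (𝓝 (1 - x ^ 2 * 0)) :=
    ((tendsto_inv_atTop_zero.comp (tendsto_atTop_add_const_right _ _ h1)).const_mul _).const_sub _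
  rw [mul_zero, sub_zero] at h2
  refine h2.congr' ?_
  filter_upwards [eventually_gt_atTop 0] with y hy
  field_simp
  ring

/-- **Nevanlinna's theorem** for Cauchy transforms: a holomorphic function `G` with nonpositive
imaginary part on the upper half-plane and `iy G(iy) → 1` is the Cauchy transform of a probability
measure. -/
theorem exists_cauchyG_eq {G : ℂ → ℂ} (hd : DifferentiableOn ℂ G UHP)
    (him : ∀ z ∈ UHP, (G z).im ≤ 0)
    (hlim : Tendsto (fun y : ℝ => (y : ℂ) * I * G (y * I)) atTop (𝓝 1)) :
    ∃ μ : Measure ℝ, IsProbabilityMeasure μ ∧ ∀ z ∈ UHP, cauchyG μ z = G z := by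
  obtain ⟨σ, hσ⟩ := exists_finiteMeasure_poissonKernel_eq_re (P := fun u => I * G (invCayley u))
    ((hd.comp differentiableOn_invCayley fun u hu => invCayley_mem_UHP hu).const_mul I)
    (fun u hu => by simpa using him _ (invCayley_mem_UHP hu))
  have hG : ∀ z ∈ UHP, ∫ ζ : Metric.sphere (0 : ℂ) 1, poissonKernel 0 ((z - I) / (z + I)) ζ
      ∂(σ : Measure (Metric.sphere (0 : ℂ) 1)) = -(G z).im := fun z hz => by
    rw [hσ _ (cayley_mem_ball hz), invCayley_cayley hz]
    simp
  have hnorm : ∀ ζ : Metric.sphere (0 : ℂ) 1, ‖(ζ : ℂ)‖ = 1 := fun ζ => by simp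
  let X : Metric.sphere (0 : ℂ) 1 → ℝ := fun ζ => (invCayley ζ).re
  have hX : Measurable X := by unfold X invCayley; fun_prop
  let g : Metric.sphere (0 : ℂ) 1 → ENNReal := fun ζ =>
    if (ζ : ℂ) = 1 then ⊤ else ENNReal.ofReal (1 + X ζ ^ 2)
  have hg : Measurable g := by
    refine Measurable.ite ?_ measurable_const (by fun_prop)
    exact measurable_subtype_coe (measurableSet_singleton 1)
  let y : ℕ → ℝ := fun n => n + 1
  have hy0 : ∀ n, 0 < y n := fun n => by positivity
  have hytop : Tendsto y atTop atTop :=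
    tendsto_atTop_add_const_right _ _ tendsto_natCast_atTop_atTop
  have hymono : Monotone y := fun m n h => by
    simp only [y]; gcongr
  let K : ℕ → Metric.sphere (0 : ℂ) 1 → ℝ := fun n ζ =>
    y n * poissonKernel 0 ((y n * I - I) / (y n * I + I)) ζ
  have hK1 : ∀ n, ∀ ζ : Metric.sphere (0 : ℂ) 1, (ζ : ℂ) = 1 → K n ζ = y n ^ 2 := fun n ζ h => by
    simp only [K, h, poissonKernel_cayley_one (ofReal_mul_I_mem_UHP (hy0 n))]
    simp [sq]
  have hK : ∀ n, ∀ ζ : Metric.sphere (0 : ℂ) 1, (ζ : ℂ) ≠ 1 →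
      K n ζ = (1 + X ζ ^ 2) * (y n ^ 2 / (y n ^ 2 + X ζ ^ 2)) := fun n ζ h => by
    simp only [K, poissonKernel_cayley (ofReal_mul_I_mem_UHP (hy0 n)) (hnorm ζ) h]
    exact mul_im_mul_norm_inv_sq _ _
  have hKcont : ∀ n, Continuous (K n) := fun n =>
    continuous_const.mul
      (continuousOn_poissonKernel (cayley_mem_ball (ofReal_mul_I_mem_UHP (hy0 n)))).domRestrict
  have hKnonneg : ∀ n ζ, 0 ≤ K n ζ := fun n ζ => by
    by_cases h : (ζ : ℂ) = 1
    · rw [hK1 n ζ h]; positivity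
    · rw [hK n ζ h]; positivity
  have hmass : ∫⁻ ζ, g ζ ∂(σ : Measure (Metric.sphere (0 : ℂ) 1)) = 1 := by
    have h1 : Tendsto (fun n => ∫⁻ ζ, ENNReal.ofReal (K n ζ)
        ∂(σ : Measure (Metric.sphere (0 : ℂ) 1))) atTop (𝓝 (∫⁻ ζ, g ζ
        ∂(σ : Measure (Metric.sphere (0 : ℂ) 1)))) := by
      refine lintegral_tendsto_of_tendsto_of_monotone
        (fun n => (hKcont n).measurable.ennreal_ofReal.aemeasurable) (ae_of_all _ fun ζ m n h => ?_)
        (ae_of_all _ fun ζ => ?_)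
      · refine ENNReal.ofReal_le_ofReal ?_
        by_cases h1 : (ζ : ℂ) = 1
        · rw [hK1 _ ζ h1, hK1 _ ζ h1]
          exact pow_le_pow_left₀ (hy0 m).le (hymono h) 2
        · rw [hK _ ζ h1, hK _ ζ h1]
          exact mul_le_mul_of_nonneg_left (sq_div_sq_add_mono (hy0 m) (hymono h) _) (by positivity)
      · by_cases h1 : (ζ : ℂ) = 1
        · simp only [g, h1, if_true, hK1 _ ζ h1]
          exact ENNReal.tendsto_ofReal_atTop.comp ((tendsto_pow_atTop two_ne_zero).comp hytop)
        · simp only [g, h1, if_false, hK _ ζ h1]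
          refine ENNReal.tendsto_ofReal ?_
          simpa using ((tendsto_sq_div_sq_add (X ζ)).comp hytop).const_mul (1 + X ζ ^ 2)
    have h2 : ∀ n, ∫⁻ ζ, ENNReal.ofReal (K n ζ) ∂(σ : Measure (Metric.sphere (0 : ℂ) 1)) =
        ENNReal.ofReal ((y n : ℂ) * I * G (y n * I)).re := fun n => by
      rw [← ofReal_integral_eq_lintegral_ofReal
        ((hKcont n).integrable_of_hasCompactSupport (HasCompactSupport.of_compactSpace _))
        (ae_of_all _ (hKnonneg n)), integral_const_mul, hG _ (ofReal_mul_I_mem_UHP (hy0 n))]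
      simp
    simp only [h2] at h1
    have h3 := ENNReal.tendsto_ofReal ((continuous_re.tendsto _).comp (hlim.comp hytop))
    simpa using tendsto_nhds_unique h1 h3
  have hfin : ∀ᵐ ζ ∂(σ : Measure (Metric.sphere (0 : ℂ) 1)), g ζ < ⊤ :=
    ae_lt_top hg (by simp [hmass])
  let μ : Measure ℝ := ((σ : Measure (Metric.sphere (0 : ℂ) 1)).withDensity g).map X
  have hμ : IsProbabilityMeasure μ := by
    constructor
    rw [Measure.map_apply hX .univ, preimage_univ, withDensity_apply _ .univ, setLIntegral_univ,
      hmass]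
  have himμ : ∀ z ∈ UHP, (cauchyG μ z).im = (G z).im := fun z hz => by
    rw [im_cauchyG hz, integral_map hX.aemeasurable (Measurable.aestronglyMeasurable (by fun_prop)),
      integral_withDensity_eq_integral_toReal_smul hg hfin, ← integral_const_mul,
      neg_eq_iff_eq_neg, ← hG z hz]
    refine integral_congr_ae ?_
    filter_upwards [hfin] with ζ hζ
    have h1 : (ζ : ℂ) ≠ 1 := fun h => by simp [g, h] at hζ
    rw [poissonKernel_cayley hz (hnorm ζ) h1]
    simp only [g, h1, if_false, smul_eq_mul]
    rw [ENNReal.toReal_ofReal (by positivity)]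
  refine ⟨μ, hμ, fun z hz => ?_⟩
  obtain ⟨w, hw⟩ := exists_eqOn_const_of_im_eq_zero ((differentiableOn_cauchyG μ).sub hd)
    (fun z hz => by simp [himμ z hz])
  have hw0 : w = 0 := by
    have h1 : Tendsto (fun y : ℝ => cauchyG μ (y * I) - G (y * I)) atTop (𝓝 (0 - 0)) := by
      refine ((tendsto_cauchyG μ 1).comp (tendsto_ofReal_mul_I_coneAtTop one_pos)).sub ?_
      have h2 := tendsto_atTop_ofReal_inv.mul hlim
      rw [zero_mul] at h2
      refine h2.congr' ?_
      filter_upwards [eventually_gt_atTop 0] with y hy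
      have : (y : ℂ) * I ≠ 0 := by simpa using sub_ofReal_ne_zero (ofReal_mul_I_mem_UHP hy) 0
      rw [inv_mul_cancel_left₀ this]
    rw [sub_zero] at h1
    refine tendsto_nhds_unique (tendsto_const_nhds.congr' ?_) h1
    filter_upwards [eventually_gt_atTop 0] with y hy using (hw _ (ofReal_mul_I_mem_UHP hy)).symm
  exact sub_eq_zero.1 ((hw z hz).trans hw0)

/-- A holomorphic self-map `F` of the upper half-plane with `F(iy) / iy → 1` is the `F`-transform
of a probability measure. -/
theorem exists_Ftr_eq {F : ℂ → ℂ} (hd : DifferentiableOn ℂ F UHP) (hF : MapsTo F UHP UHP)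
    (hlim : Tendsto (fun y : ℝ => F (y * I) / (y * I)) atTop (𝓝 1)) :
    ∃ μ : Measure ℝ, IsProbabilityMeasure μ ∧ ∀ z ∈ UHP, Ftr μ z = F z := by
  have h0 : ∀ z ∈ UHP, F z ≠ 0 := fun z hz => by simpa using sub_ofReal_ne_zero (hF hz) 0
  obtain ⟨μ, hμ, h⟩ := exists_cauchyG_eq (G := fun z => (F z)⁻¹) (hd.inv h0)
    (fun z hz => by
      rw [inv_im]
      exact div_nonpos_of_nonpos_of_nonneg (neg_nonpos.2 (hF hz).le) (normSq_nonneg _))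
    (by simpa [div_eq_mul_inv, mul_comm, mul_left_comm, mul_assoc] using hlim.inv₀ one_ne_zero)
  exact ⟨μ, hμ, fun z hz => by rw [Ftr, h z hz, inv_inv]⟩

end Nevanlinna

section SchwarzPick

lemma norm_sub_conj_sq (a b : ℂ) : ‖a - conj b‖ ^ 2 = ‖a - b‖ ^ 2 + 4 * (a.im * b.im) := by
  simp only [← normSq_eq_norm_sq, normSq_apply, sub_re, sub_im, conj_re, conj_im]
  ring

lemma norm_sub_conj_pos {a b : ℂ} (ha : a ∈ UHP) (hb : b ∈ UHP) : 0 < ‖a - conj b‖ := by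
  have := norm_sub_conj_sq a b
  have h : 0 < a.im * b.im := mul_pos ha hb
  by_contra! h0
  nlinarith [norm_nonneg (a - conj b), sq_nonneg ‖a - b‖]

lemma norm_sub_lt_norm_sub_conj {a b : ℂ} (ha : a ∈ UHP) (hb : b ∈ UHP) :
    ‖a - b‖ < ‖a - conj b‖ := by
  have := norm_sub_conj_sq a b
  have h : 0 < a.im * b.im := mul_pos ha hb
  exact lt_of_pow_lt_pow_left₀ 2 (norm_nonneg _) (by linarith)

/-- The **Schwarz–Pick lemma** in the upper half-plane. -/
theorem norm_sub_mul_le_of_mapsTo_UHP {f : ℂ → ℂ} (hd : DifferentiableOn ℂ f UHP)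
    (hf : MapsTo f UHP UHP) {a b : ℂ} (ha : a ∈ UHP) (hb : b ∈ UHP) :
    ‖f a - f b‖ * ‖a - conj b‖ ≤ ‖a - b‖ * ‖f a - conj (f b)‖ := by
  let c : ℂ → ℂ := fun u => b.re + b.im * invCayley u
  have hc : MapsTo c (Metric.ball 0 1) UHP := fun u hu => by
    have := mul_pos (mem_UHP.1 hb) (mem_UHP.1 (invCayley_mem_UHP hu))
    simpa [c, UHP] using this
  have hcd : DifferentiableOn ℂ c (Metric.ball 0 1) :=
    (differentiableOn_invCayley.const_mul _).const_add _
  have hfc := fun u hu => hf (hc (x := u) hu)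
  have hq : DifferentiableOn ℂ (fun u => (f (c u) - f b) / (f (c u) - conj (f b)))
      (Metric.ball 0 1) := by
    have hdc := hd.comp hcd hc
    exact (hdc.sub_const _).div (hdc.sub_const _) fun u hu =>
      norm_pos_iff.1 (norm_sub_conj_pos (hfc u hu) (hf hb))
  have hmaps : MapsTo (fun u => (f (c u) - f b) / (f (c u) - conj (f b)))
      (Metric.ball 0 1) (Metric.closedBall 0 1) := fun u hu => by
    rw [mem_closedBall_zero_iff, norm_div, div_le_one (norm_sub_conj_pos (hfc u hu) (hf hb))]
    exact (norm_sub_lt_norm_sub_conj (hfc u hu) (hf hb)).le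
  have hc0 : c 0 = b := by
    simp only [c, invCayley, add_zero, sub_zero, mul_one, div_one]
    exact re_add_im b
  have hab := norm_sub_conj_pos ha hb
  have hab0 : a - conj b ≠ 0 := norm_pos_iff.1 hab
  have hu : ‖(a - b) / (a - conj b)‖ < 1 := by
    rw [norm_div, div_lt_one hab]
    exact norm_sub_lt_norm_sub_conj ha hb
  have hca : c ((a - b) / (a - conj b)) = a := by
    have hbim : (b.im : ℂ) ≠ 0 := ofReal_ne_zero.2 (mem_UHP.1 hb).ne'
    have h1 : b - conj b = 2 * b.im * I := by
      rw [sub_conj]; push_cast; ring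
    have h2 : b + conj b = 2 * b.re := by
      rw [add_conj]; push_cast; ring
    have h3 : (1 : ℂ) - (a - b) / (a - conj b) = 2 * b.im * I / (a - conj b) := by
      rw [← h1]; field_simp; ring
    have h4 : (1 : ℂ) + (a - b) / (a - conj b) = 2 * (a - b.re) / (a - conj b) := by
      field_simp
      linear_combination -h2
    simp only [c, invCayley, h3, h4]
    field_simp
    ring
  have := norm_le_norm_of_mapsTo_ball hq hmaps (by simp [hc0]) hu
  simp only [hca, norm_div] at this
  rwa [div_le_div_iff₀ (norm_sub_conj_pos (hf ha) (hf hb)) hab] at this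

lemma norm_mul_one_sub_le_of_mapsTo_UHP {f : ℂ → ℂ} (hd : DifferentiableOn ℂ f UHP)
    (hf : MapsTo f UHP UHP) {a b : ℂ} (ha : a ∈ UHP) (hb : b ∈ UHP) {k : ℝ}
    (hk : ‖a - b‖ ≤ k * ‖a - conj b‖) : ‖f a‖ * (1 - k) ≤ ‖f b‖ * (1 + k) := by
  have hab := norm_sub_conj_pos ha hb
  have hk0 : 0 ≤ k := nonneg_of_mul_nonneg_left ((norm_nonneg _).trans hk) hab
  have h1 : ‖f a - f b‖ * ‖a - conj b‖ ≤ (k * ‖f a - conj (f b)‖) * ‖a - conj b‖ :=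
    (norm_sub_mul_le_of_mapsTo_UHP hd hf ha hb).trans <| by
      have := mul_le_mul_of_nonneg_right hk (norm_nonneg (f a - conj (f b)))
      linarith
  have h2 := le_of_mul_le_mul_right h1 hab
  have h3 : ‖f a - conj (f b)‖ ≤ ‖f a‖ + ‖f b‖ := by
    simpa using norm_sub_le (f a) (conj (f b))
  have h4 := norm_sub_norm_le (f a) (f b)
  nlinarith [mul_le_mul_of_nonneg_left h3 hk0]

lemma exists_lt_one_le_mul_of_sq_le {c : ℝ} (hc : 0 < c) {D : ℝ} (hD : 0 < D) :
    ∃ q, 0 ≤ q ∧ q < 1 ∧ ∀ A B : ℝ, A ^ 2 ≤ B ^ 2 - c → 0 ≤ B → B ≤ D → A ≤ q * B := by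
  refine ⟨√(1 - c / D ^ 2), Real.sqrt_nonneg _, ?_, fun A B h hB hBD => ?_⟩
  · rw [Real.sqrt_lt' one_pos, one_pow, sub_lt_self_iff]
    positivity
  · have h1 : c / D ^ 2 * B ^ 2 ≤ c := by
      rw [div_mul_eq_mul_div, div_le_iff₀ (by positivity)]
      gcongr
    have h2 := (le_abs_self A).trans (Real.abs_le_sqrt
      (show A ^ 2 ≤ (1 - c / D ^ 2) * B ^ 2 by linarith))
    rwa [Real.sqrt_mul' _ (sq_nonneg B), Real.sqrt_sq hB] at h2

end SchwarzPick

section FixedPoint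

/-- The iterates `z, T z z, T z (T z z), …` of a family of self-maps `T z`. -/
def famIterate (T : ℂ → ℂ → ℂ) : ℕ → ℂ → ℂ
  | 0, z => z
  | n + 1, z => T z (famIterate T n z)

variable {T : ℂ → ℂ → ℂ}

lemma im_le_im_famIterate (him : ∀ z ∈ UHP, ∀ w ∈ UHP, z.im ≤ (T z w).im) {z : ℂ} (hz : z ∈ UHP)
    (n : ℕ) : z.im ≤ (famIterate T n z).im := by
  induction n with
  | zero => exact le_rfl
  | succ n ih => exact him z hz _ (lt_of_lt_of_le hz ih)

lemma famIterate_mem_UHP (him : ∀ z ∈ UHP, ∀ w ∈ UHP, z.im ≤ (T z w).im) (n : ℕ) :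
    MapsTo (famIterate T n) UHP UHP :=
  fun _ hz => lt_of_lt_of_le hz (im_le_im_famIterate him hz n)

lemma differentiableOn_famIterate (him : ∀ z ∈ UHP, ∀ w ∈ UHP, z.im ≤ (T z w).im)
    (hcomp : ∀ g : ℂ → ℂ, DifferentiableOn ℂ g UHP → MapsTo g UHP UHP →
      DifferentiableOn ℂ (fun z => T z (g z)) UHP) (n : ℕ) :
    DifferentiableOn ℂ (famIterate T n) UHP := by
  induction n with
  | zero => exact differentiableOn_id
  | succ n ih => exact hcomp _ ih (famIterate_mem_UHP him n)

lemma norm_famIterate_sub_le {z : ℂ} {r : ℝ} (hr : 0 ≤ r)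
    (hT : ∀ w, ‖w - z‖ ≤ r → ‖T z w - z‖ ≤ r) (n : ℕ) : ‖famIterate T n z - z‖ ≤ r := by
  induction n with
  | zero => simpa [famIterate] using hr
  | succ n ih => exact hT _ ih

/-- The iterates converge geometrically, uniformly on compact subsets of the half-plane. -/
lemma exists_dist_famIterate_succ_le (hd : ∀ z ∈ UHP, DifferentiableOn ℂ (T z) UHP)
    (hcomp : ∀ g : ℂ → ℂ, DifferentiableOn ℂ g UHP → MapsTo g UHP UHP →
      DifferentiableOn ℂ (fun z => T z (g z)) UHP)
    (him : ∀ z ∈ UHP, ∀ w ∈ UHP, z.im ≤ (T z w).im)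
    {b : ℂ} (hb : b ∈ UHP) {r : ℝ} (hr : 0 < r) (hTb : ∀ w, ‖w - b‖ ≤ r → ‖T b w - b‖ ≤ r)
    {y₀ R : ℝ} (hy₀ : 0 < y₀) (hR : 0 < R) :
    ∃ C q : ℝ, 0 ≤ q ∧ q < 1 ∧ ∀ z : ℂ, y₀ ≤ z.im → ‖z‖ ≤ R → ∀ n,
      dist (famIterate T n z) (famIterate T (n + 1) z) ≤ C * q ^ n := by
  have hbim : 0 < b.im := hb
  obtain ⟨k, hk0, hk1, hk⟩ := exists_lt_one_le_mul_of_sq_le (c := 4 * (y₀ * b.im)) (by positivity)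
    (D := R + ‖b‖) (by positivity)
  let C : ℝ := (‖b‖ + r) * (1 + k) / (1 - k)
  have hk1' : 0 < 1 - k := sub_pos.2 hk1
  have hC : 0 < C := by positivity
  have hbound : ∀ z : ℂ, y₀ ≤ z.im → ‖z‖ ≤ R → ∀ n, ‖famIterate T n z‖ ≤ C := by
    intro z hz hzR n
    have hzU : z ∈ UHP := lt_of_lt_of_le hy₀ hz
    have h1 : ‖z - conj b‖ ≤ R + ‖b‖ := by
      have := norm_sub_le z (conj b)
      rw [norm_conj] at this
      linarith
    have h2 := hk ‖z - b‖ ‖z - conj b‖ (by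
      rw [norm_sub_conj_sq]
      nlinarith [mul_le_mul_of_nonneg_right hz hbim.le]) (norm_nonneg _) h1
    have h3 := norm_mul_one_sub_le_of_mapsTo_UHP (differentiableOn_famIterate him hcomp n)
      (famIterate_mem_UHP him n) hzU hb h2
    have h4 : ‖famIterate T n b‖ ≤ ‖b‖ + r := by
      have := norm_sub_norm_le (famIterate T n b) b
      linarith [norm_famIterate_sub_le hr.le hTb n]
    rw [le_div_iff₀ hk1']
    exact h3.trans (by gcongr)
  obtain ⟨q, hq0, hq1, hq⟩ := exists_lt_one_le_mul_of_sq_le (c := 3 * y₀ ^ 2) (by positivity)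
    (D := 2 * C) (by positivity)
  refine ⟨2 * C, q, hq0, hq1, fun z hz hzR n => ?_⟩
  have hzU : z ∈ UHP := lt_of_lt_of_le hy₀ hz
  have hmem := fun n => famIterate_mem_UHP him n hzU
  have hD : ∀ n, ‖famIterate T (n + 1) z - conj (famIterate T n z)‖ ≤ 2 * C := fun n => by
    have := norm_sub_le (famIterate T (n + 1) z) (conj (famIterate T n z))
    rw [norm_conj] at this
    linarith [hbound z hz hzR n, hbound z hz hzR (n + 1)]
  have hstep : ∀ n, ‖famIterate T (n + 1) z - famIterate T n z‖ ≤
      q ^ n * ‖famIterate T (n + 1) z - conj (famIterate T n z)‖ := by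
    intro n
    induction n with
    | zero => simpa using (norm_sub_lt_norm_sub_conj (hmem 1) (hmem 0)).le
    | succ n ih =>
      set a := famIterate T n z with ha
      set a' := famIterate T (n + 1) z with ha'
      have hau : T z a = a' := rfl
      have ha'u : T z a' = famIterate T (n + 2) z := rfl
      have hs := norm_sub_mul_le_of_mapsTo_UHP (f := fun w => T z w - ((y₀ / 2 : ℝ) : ℂ) * I)
        ((hd z hzU).sub_const _) (fun w hw => by
          have := him z hzU w hw
          rw [mem_UHP, sub_im, im_ofReal_mul, I_im]
          linarith) (hmem (n + 1)) (hmem n)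
      simp only [← ha, ← ha', hau, ha'u, sub_sub_sub_cancel_right] at hs
      set a'' := famIterate T (n + 2) z with ha''
      have h1 : ‖a'' - (y₀ / 2 : ℝ) * I - conj (a' - (y₀ / 2 : ℝ) * I)‖ ≤
          q * ‖a'' - conj a'‖ := by
        refine hq _ _ ?_ (norm_nonneg _) (hD (n + 1))
        have i1 : y₀ ≤ a'.im := hz.trans (im_le_im_famIterate him hzU (n + 1))
        have i2 : y₀ ≤ a''.im := hz.trans (im_le_im_famIterate him hzU (n + 2))
        rw [norm_sub_conj_sq, norm_sub_conj_sq, sub_sub_sub_cancel_right]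
        simp only [sub_im, im_ofReal_mul, I_im]
        nlinarith
      have hpos := norm_sub_conj_pos (hmem (n + 1)) (hmem n)
      refine le_of_mul_le_mul_right (hs.trans ?_) hpos
      calc ‖a' - a‖ * ‖a'' - (y₀ / 2 : ℝ) * I - conj (a' - (y₀ / 2 : ℝ) * I)‖
          ≤ (q ^ n * ‖a' - conj a‖) * (q * ‖a'' - conj a'‖) := by gcongr
        _ = q ^ (n + 1) * ‖a'' - conj a'‖ * ‖a' - conj a‖ := by ring
  rw [dist_comm, dist_eq_norm]
  refine (hstep n).trans ?_
  rw [mul_comm]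
  gcongr
  exact hD n

/-- A holomorphic family `T z` of self-maps of the upper half-plane with `Im T z w ≥ Im z`, which
preserves small discs around `z = iy` for large `y`, has a holomorphic family of fixed points. -/
theorem exists_fixedPoint_family (hd : ∀ z ∈ UHP, DifferentiableOn ℂ (T z) UHP)
    (hcomp : ∀ g : ℂ → ℂ, DifferentiableOn ℂ g UHP → MapsTo g UHP UHP →
      DifferentiableOn ℂ (fun z => T z (g z)) UHP)
    (him : ∀ z ∈ UHP, ∀ w ∈ UHP, z.im ≤ (T z w).im)
    (hT : ∀ ε : ℝ, 0 < ε → ε ≤ 1 / 2 → ∀ᶠ y : ℝ in atTop, ∀ w : ℂ,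
      ‖w - y * I‖ ≤ ε * y → ‖T (y * I) w - y * I‖ ≤ ε * y) :
    ∃ ω : ℂ → ℂ, DifferentiableOn ℂ ω UHP ∧ (∀ z ∈ UHP, z.im ≤ (ω z).im) ∧
      (∀ z ∈ UHP, T z (ω z) = ω z) ∧
      Tendsto (fun y : ℝ => ω (y * I) / (y * I)) atTop (𝓝 1) := by
  obtain ⟨Y, hY0, hY⟩ := ((eventually_gt_atTop 0).and (hT (1 / 2) (by norm_num) le_rfl)).exists
  have hgeo := fun {y₀ R : ℝ} (hy₀ : 0 < y₀) (hR : 0 < R) =>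
    exists_dist_famIterate_succ_le hd hcomp him (ofReal_mul_I_mem_UHP hY0)
      (show 0 < 1 / 2 * Y by positivity) hY hy₀ hR
  have hlim : ∀ z, ∃ l, z ∈ UHP → Tendsto (fun n => famIterate T n z) atTop (𝓝 l) := fun z => by
    by_cases hz : z ∈ UHP
    · obtain ⟨C, q, -, hq, h⟩ := hgeo hz (show 0 < ‖z‖ + 1 by positivity)
      obtain ⟨l, hl⟩ := cauchySeq_tendsto_of_complete
        (cauchySeq_of_le_geometric q C hq (h z le_rfl (by simp)))
      exact ⟨l, fun _ => hl⟩
    · exact ⟨0, fun h => absurd h hz⟩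
  choose ω hω using hlim
  have hωim : ∀ z ∈ UHP, z.im ≤ (ω z).im := fun z hz =>
    ge_of_tendsto ((continuous_im.tendsto _).comp (hω z hz))
      (.of_forall fun n => im_le_im_famIterate him hz n)
  have hunif : TendstoLocallyUniformlyOn (famIterate T) ω atTop UHP := by
    rw [Metric.tendstoLocallyUniformlyOn_iff]
    intro ε hε x hx
    have hx0 : 0 < x.im := hx
    obtain ⟨C, q, hq0, hq1, h⟩ := hgeo (half_pos hx0) (show 0 < ‖x‖ + 1 by positivity)
    have hq : Tendsto (fun n => C * q ^ n / (1 - q)) atTop (𝓝 (C * 0 / (1 - q))) :=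
      ((tendsto_pow_atTop_nhds_zero_of_lt_one hq0 hq1).const_mul C).div_const _
    rw [mul_zero, zero_div] at hq
    refine ⟨{z | x.im / 2 < z.im ∧ ‖z‖ < ‖x‖ + 1}, mem_nhdsWithin_of_mem_nhds ?_, ?_⟩
    · exact ((isOpen_lt continuous_const continuous_im).inter
        (isOpen_lt continuous_norm continuous_const)).mem_nhds 
          ⟨half_lt_self hx0, show ‖x‖ < ‖x‖ + 1 from lt_add_one _⟩
    · filter_upwards [hq.eventually_lt_const hε] with n hn z hz
      rw [dist_comm]
      exact (dist_le_of_le_geometric_of_tendsto q C hq1 (h z hz.1.le hz.2.le)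
        (hω z ((half_pos hx0).trans hz.1)) n).trans_lt hn
  refine ⟨ω, hunif.differentiableOn (.of_forall fun n => differentiableOn_famIterate him hcomp n)
    isOpen_UHP, hωim, fun z hz => ?_, ?_⟩
  · have hcont : ContinuousAt (T z) (ω z) := (hd z hz).continuousOn.continuousAt
      (isOpen_UHP.mem_nhds (lt_of_lt_of_le hz (hωim z hz)))
    exact tendsto_nhds_unique (hcont.tendsto.comp (hω z hz))
      ((hω z hz).comp (tendsto_add_atTop_nat 1))
  · rw [Metric.tendsto_nhds]
    intro ε hε
    filter_upwards [eventually_gt_atTop 0, hT (min (ε / 2) (1 / 2)) (by positivity)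
      (min_le_right _ _)] with y hy hTy
    have h1 : ‖ω (y * I) - y * I‖ ≤ min (ε / 2) (1 / 2) * y :=
      le_of_tendsto ((hω _ (ofReal_mul_I_mem_UHP hy)).sub_const _).norm
        (.of_forall fun n => norm_famIterate_sub_le (by positivity) hTy n)
    have hyI : (y : ℂ) * I ≠ 0 := by simpa using sub_ofReal_ne_zero (ofReal_mul_I_mem_UHP hy) 0
    have hn : ‖(y : ℂ) * I‖ = y := by simp [abs_of_pos hy]
    rw [dist_eq_norm, div_sub_one hyI, norm_div, hn, div_lt_iff₀ hy]
    refine h1.trans_lt ?_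
    have := min_le_left (ε / 2) (1 / 2)
    nlinarith

end FixedPoint

/-- **Analytic subordination** for free additive convolution. -/
theorem exists_subordination (ρ ν : Measure ℝ) [IsProbabilityMeasure ρ] [IsProbabilityMeasure ν] :
    ∃ ω : Measure ℝ, IsProbabilityMeasure ω ∧
      ∀ z ∈ UHP, Ftr ν (z + (Ftr ρ (Ftr ω z) - Ftr ω z)) = Ftr ρ (Ftr ω z) := by
  have hH : ∀ z ∈ UHP, ∀ w ∈ UHP, z.im ≤ (z + (Ftr ρ w - w)).im := fun z hz w hw => by
    rw [add_im, sub_im]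
    linarith [im_le_im_Ftr (μ := ρ) hw]
  have hHU : ∀ z ∈ UHP, ∀ w ∈ UHP, z + (Ftr ρ w - w) ∈ UHP := fun z hz w hw =>
    lt_of_lt_of_le hz (hH z hz w hw)
  let T : ℂ → ℂ → ℂ := fun z w => Ftr ν (z + (Ftr ρ w - w)) - (Ftr ρ w - w)
  obtain ⟨ω, hωd, hωim, hω, hωlim⟩ : ∃ ω : ℂ → ℂ, DifferentiableOn ℂ ω UHP ∧
      (∀ z ∈ UHP, z.im ≤ (ω z).im) ∧ (∀ z ∈ UHP, T z (ω z) = ω z) ∧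
      Tendsto (fun y : ℝ => ω (y * I) / (y * I)) atTop (𝓝 1) := by
    refine exists_fixedPoint_family ?_ ?_ ?_ ?_
    · intro z hz
      have h1 : DifferentiableOn ℂ (fun w => Ftr ρ w - w) UHP :=
        (differentiableOn_Ftr ρ).sub differentiableOn_id
      exact ((differentiableOn_Ftr ν).comp (h1.const_add z) fun w hw => hHU z hz w hw).sub h1
    · intro g hg hgU
      have h1 : DifferentiableOn ℂ (fun z => Ftr ρ (g z) - g z) UHP :=
        ((differentiableOn_Ftr ρ).comp hg hgU).sub hg
      exact ((differentiableOn_Ftr ν).comp (differentiableOn_id.add h1)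
        fun z hz => hHU z hz _ (hgU hz)).sub h1
    · intro z hz w hw
      have := im_le_im_Ftr (μ := ν) (hHU z hz w hw)
      simp only [T, add_im, sub_im] at this ⊢
      linarith
    · intro ε hε hε2
      obtain ⟨M₁, hM₁, h₁⟩ := exists_norm_Ftr_sub_le ρ 2 (show 0 < ε / 4 by positivity)
      obtain ⟨M₂, hM₂, h₂⟩ := exists_norm_Ftr_sub_le ν 2 (show 0 < ε / 4 by positivity)
      filter_upwards [eventually_gt_atTop (2 * M₁), eventually_gt_atTop M₂] with y hy₁ hy₂ w hw
      have hy : 0 < y := hM₂.trans hy₂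
      have hn : ‖(y : ℂ) * I‖ = y := by simp [abs_of_pos hy]
      have hwy : ‖w - y * I‖ ≤ y / 2 := hw.trans (by nlinarith)
      have hre : |w.re| ≤ y / 2 := by simpa using (abs_re_le_norm (w - y * I)).trans hwy
      have him : y / 2 ≤ w.im := by
        have := (abs_le.1 ((abs_im_le_norm (w - y * I)).trans hwy)).1
        simp at this
        linarith
      have hwn : ‖w‖ ≤ 3 / 2 * y := by linarith [norm_sub_norm_le w (y * I)]
      have hHw : ‖Ftr ρ w - w‖ ≤ ε * y * (3 / 8) :=
        (h₁ w ⟨by linarith, by linarith⟩).trans (by nlinarith)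
      have hHw' : ‖Ftr ρ w - w‖ ≤ y / 4 := hHw.trans (by nlinarith)
      have hvim := hH _ (ofReal_mul_I_mem_UHP hy) w (show 0 < w.im by linarith)
      have hvre : |(y * I + (Ftr ρ w - w)).re| ≤ y / 4 := by
        simpa using (abs_re_le_norm (Ftr ρ w - w)).trans hHw'
      have hvn : ‖y * I + (Ftr ρ w - w)‖ ≤ 5 / 4 * y := by
        linarith [norm_add_le (y * I) (Ftr ρ w - w)]
      rw [im_ofReal_mul, I_im, mul_one] at hvim
      have h := h₂ (y * I + (Ftr ρ w - w)) ⟨by linarith, by linarith⟩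
      rw [← sub_sub] at h
      rw [show T (y * I) w - y * I = _ from sub_right_comm _ _ _]
      exact h.trans (by nlinarith)
  have hωU : MapsTo ω UHP UHP := fun z hz => lt_of_lt_of_le hz (hωim z hz)
  obtain ⟨μ, hμ, h⟩ := exists_Ftr_eq hωd hωU hωlim
  refine ⟨μ, hμ, fun z hz => ?_⟩
  rw [h z hz]
  exact (sub_eq_iff_eq_add.1 (hω z hz)).trans (add_sub_cancel _ _)

section Cones

lemma isVT_iff {μ : Measure ℝ} {φ : ℂ → ℂ} :
    IsVT μ φ ↔ ∃ α, 0 < α ∧ ∀ᶠ z in coneAtTop α, φ (Ftr μ z) + Ftr μ z = z := by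
  simp only [IsVT, eventually_coneAtTop]
  exact exists_congr fun α => by simp only [exists_and_left]

lemma tendsto_coneAtTop_of_tendsto_div {f : ℂ → ℂ} {α α' : ℝ} (hα : 0 < α) (hαα' : α < α')
    (him : ∀ z ∈ UHP, z.im ≤ (f z).im)
    (hf : Tendsto (fun z => f z / z) (coneAtTop α) (𝓝 1)) :
    Tendsto f (coneAtTop α) (coneAtTop α') := by
  refine tendsto_inf.2 ⟨tendsto_comap_iff.2 ?_, tendsto_principal.2 ?_⟩
  · refine tendsto_atTop_mono' _ ?_ (tendsto_comap.mono_left inf_le_left)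
    filter_upwards [eventually_im_pos_coneAtTop α] with z hz using him z hz
  · have hε : 0 < (α' - α) / (α + 1) := div_pos (sub_pos.2 hαα') (by positivity)
    filter_upwards [Metric.tendsto_nhds.1 hf _ hε, eventually_im_pos_coneAtTop α,
      eventually_cone_coneAtTop α] with z hd hz hc
    have hz0 : z ≠ 0 := by simpa using sub_ofReal_ne_zero hz 0
    have hz1 : 0 < z.im := hz
    have h1 : ‖f z - z‖ ≤ (α' - α) / (α + 1) * ‖z‖ := by
      have e : f z - z = (f z / z - 1) * z := by field_simp
      rw [e, norm_mul]
      rw [dist_eq_norm] at hd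
      gcongr
    have h2 : ‖z‖ ≤ (α + 1) * z.im := by
      have := norm_le_abs_re_add_abs_im z
      rw [abs_of_pos hz1] at this
      linarith
    have h3 : ‖f z - z‖ ≤ (α' - α) * z.im := by
      refine h1.trans ((mul_le_mul_of_nonneg_left h2 hε.le).trans_eq ?_)
      field_simp
    have h4 : |(f z).re| ≤ |z.re| + ‖f z - z‖ := by
      have := abs_re_le_norm (f z - z)
      rw [sub_re] at this
      linarith [abs_sub_abs_le_abs_sub (f z).re z.re]
    have h5 := mul_le_mul_of_nonneg_left (him z hz) (hα.trans hαα').le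
    show |(f z).re| < α' * (f z).im
    linarith

variable {α α' : ℝ} (μ ρ : Measure ℝ) [IsProbabilityMeasure μ] [IsProbabilityMeasure ρ]

lemma tendsto_Ftr_coneAtTop (hα : 0 < α) (h : α < α') :
    Tendsto (Ftr μ) (coneAtTop α) (coneAtTop α') :=
  tendsto_coneAtTop_of_tendsto_div hα h (fun _ hz => im_le_im_Ftr hz) (tendsto_Ftr_div μ α)

lemma tendsto_Ftr_comp_div (hα : 0 < α) :
    Tendsto (fun z => Ftr ρ (Ftr μ z) / z) (coneAtTop α) (𝓝 1) := by
  have h1 := ((tendsto_Ftr_div ρ (α + 1)).comp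
    (tendsto_Ftr_coneAtTop μ hα (lt_add_one α))).mul (tendsto_Ftr_div μ α)
  rw [mul_one] at h1
  refine h1.congr' ?_
  filter_upwards [eventually_im_pos_coneAtTop α] with z hz
  have hF : Ftr μ z ≠ 0 := by simpa using sub_ofReal_ne_zero (Ftr_mem_UHP (μ := μ) hz) 0
  exact div_mul_div_cancel₀ hF

lemma tendsto_add_Ftr_comp_sub_coneAtTop (hα : 0 < α) (h : α < α') :
    Tendsto (fun z => z + (Ftr ρ (Ftr μ z) - Ftr μ z)) (coneAtTop α) (coneAtTop α') := by
  refine tendsto_coneAtTop_of_tendsto_div hα h (fun z hz => ?_) ?_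
  · rw [add_im, sub_im]
    linarith [im_le_im_Ftr (μ := ρ) (Ftr_mem_UHP (μ := μ) hz)]
  · have h1 := ((tendsto_Ftr_comp_div μ ρ hα).sub (tendsto_Ftr_div μ α)).const_add 1
    rw [sub_self, add_zero] at h1
    refine h1.congr' ?_
    filter_upwards [eventually_im_pos_coneAtTop α] with z hz
    have hz0 : z ≠ 0 := by simpa using sub_ofReal_ne_zero hz 0
    field_simp

lemma exists_Ftr_eq_comp :
    ∃ m : Measure ℝ, IsProbabilityMeasure m ∧ ∀ z ∈ UHP, Ftr m z = Ftr ρ (Ftr μ z) :=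
  exists_Ftr_eq ((differentiableOn_Ftr ρ).comp (differentiableOn_Ftr μ) fun _ hz => Ftr_mem_UHP hz)
    (fun _ hz => Ftr_mem_UHP (Ftr_mem_UHP hz))
    ((tendsto_Ftr_comp_div μ ρ one_pos).comp (tendsto_ofReal_mul_I_coneAtTop one_pos))

lemma exists_Ftr_eq_sub_cauchyG (β : ℝ) {γ : ℝ} (hγ : 0 ≤ γ) :
    ∃ P : Measure ℝ, IsProbabilityMeasure P ∧
      ∀ z ∈ UHP, Ftr P z = z - (β + γ * cauchyG μ z) := by
  refine exists_Ftr_eq (F := fun z => z - (β + γ * cauchyG μ z))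
    (differentiableOn_id.sub (((differentiableOn_cauchyG μ).const_mul _).const_add _)) ?_ ?_
  · intro z hz
    have hz0 : 0 < z.im := hz
    have := mul_nonpos_of_nonneg_of_nonpos hγ (im_cauchyG_neg (μ := μ) hz).le
    simp only [mem_UHP, sub_im, add_im, ofReal_im, im_ofReal_mul]
    linarith
  · have h1 := (tendsto_cauchyG μ 1).comp (tendsto_ofReal_mul_I_coneAtTop one_pos)
    have h2 := (((h1.const_mul (γ : ℂ)).const_add (β : ℂ)).mul tendsto_atTop_ofReal_inv).const_sub 1
    rw [mul_zero, sub_zero] at h2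
    refine h2.congr' ?_
    filter_upwards [eventually_gt_atTop 0] with y hy
    have hz0 : (y : ℂ) * I ≠ 0 := by simpa using sub_ofReal_ne_zero (ofReal_mul_I_mem_UHP hy) 0
    simp only [Function.comp]
    rw [sub_div, div_self hz0, div_eq_mul_inv]

end Cones

section Moments

variable {P m : Measure ℝ} [IsProbabilityMeasure P] [IsProbabilityMeasure m] {β γ : ℝ}

lemma sq_mul_one_sub_mul_inv_sub {y : ℝ} (hy : 0 < y) (x : ℝ) :
    (y : ℂ) ^ 2 * (1 - y * I * (y * I - x)⁻¹) =
      ((x ^ 2 * (y ^ 2 / (y ^ 2 + x ^ 2)) : ℝ) : ℂ) +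
        ((y * (x * (y ^ 2 / (y ^ 2 + x ^ 2))) : ℝ) : ℂ) * I := by
  have h1 := sub_ofReal_ne_zero (ofReal_mul_I_mem_UHP hy) x
  have h2 : ((y : ℂ) ^ 2 + x ^ 2) ≠ 0 := by
    have : y ^ 2 + x ^ 2 ≠ 0 := by positivity
    exact_mod_cast this
  push_cast
  field_simp
  linear_combination (-(x : ℂ) * y ^ 4) * I_sq

lemma integral_sq_mul_one_sub {y : ℝ} (hy : 0 < y) :
    Integrable (fun x : ℝ => x ^ 2 * (y ^ 2 / (y ^ 2 + x ^ 2))) P ∧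
    ∫ x : ℝ, x ^ 2 * (y ^ 2 / (y ^ 2 + x ^ 2)) ∂P =
      ((y : ℂ) ^ 2 * (1 - y * I * cauchyG P (y * I))).re ∧
    y * ∫ x : ℝ, x * (y ^ 2 / (y ^ 2 + x ^ 2)) ∂P =
      ((y : ℂ) ^ 2 * (1 - y * I * cauchyG P (y * I))).im := by
  have hi : Integrable (fun x : ℝ => (y : ℂ) ^ 2 * (1 - y * I * (y * I - x)⁻¹)) P :=
    ((integrable_const _).sub
      ((integrable_inv_sub (ofReal_mul_I_mem_UHP hy)).const_mul _)).const_mul _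
  have he : (y : ℂ) ^ 2 * (1 - y * I * cauchyG P (y * I)) =
      ∫ x : ℝ, (y : ℂ) ^ 2 * (1 - y * I * (y * I - x)⁻¹) ∂P := by
    rw [integral_const_mul, integral_sub (integrable_const _)
      ((integrable_inv_sub (ofReal_mul_I_mem_UHP hy)).const_mul _), integral_const_mul, cauchyG]
    simp
  have hre : ∀ x : ℝ, ((y : ℂ) ^ 2 * (1 - y * I * (y * I - x)⁻¹)).re =
      x ^ 2 * (y ^ 2 / (y ^ 2 + x ^ 2)) := fun x => by
    rw [sq_mul_one_sub_mul_inv_sub hy, add_re, ofReal_re, re_ofReal_mul, I_re, mul_zero, add_zero]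
  have him : ∀ x : ℝ, ((y : ℂ) ^ 2 * (1 - y * I * (y * I - x)⁻¹)).im =
      y * (x * (y ^ 2 / (y ^ 2 + x ^ 2))) := fun x => by
    rw [sq_mul_one_sub_mul_inv_sub hy, add_im, ofReal_im, im_ofReal_mul, I_im, mul_one, zero_add]
  refine ⟨hi.re.congr (ae_of_all _ hre), ?_, ?_⟩
  · rw [he, ← integral_congr_ae (ae_of_all _ hre)]
    exact reCLM.integral_comp_comm hi
  · rw [he, ← integral_const_mul, ← integral_congr_ae (ae_of_all _ him)]
    exact imCLM.integral_comp_comm hi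

/-- Asymptotics of the Cauchy transform of `P` with `F_P(z) = z - β - γ G_m(z)`. -/
lemma exists_tendsto_sq_mul_one_sub (h : ∀ z ∈ UHP, Ftr P z = z - (β + γ * cauchyG m z)) :
    ∃ E : ℝ → ℂ, Tendsto E atTop (𝓝 ((β ^ 2 + γ : ℝ) : ℂ)) ∧ ∀ y : ℝ, 0 < y →
      (y : ℂ) ^ 2 * (1 - y * I * cauchyG P (y * I)) = ((β * y : ℝ) : ℂ) * I + E y := by
  have hI := tendsto_ofReal_mul_I_coneAtTop one_pos
  have hP := (tendsto_mul_cauchyG P 1).comp hI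
  have hm := (tendsto_mul_cauchyG m 1).comp hI
  have hm0 := (tendsto_cauchyG m 1).comp hI
  refine ⟨fun y => β * (β + γ * cauchyG m (y * I)) * (y * I * cauchyG P (y * I)) +
    γ * (y * I * cauchyG m (y * I)) * (y * I * cauchyG P (y * I)), ?_, fun y hy => ?_⟩
  · have := ((((hm0.const_mul (γ : ℂ)).const_add (β : ℂ)).const_mul (β : ℂ)).mul hP).add
      ((hm.const_mul (γ : ℂ)).mul hP)
    rwa [show (β : ℂ) * (β + γ * 0) * 1 + γ * 1 * 1 = ((β ^ 2 + γ : ℝ) : ℂ) by push_cast; ring]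
      at this
  · have hz := ofReal_mul_I_mem_UHP hy
    have hG := cauchyG_ne_zero (μ := P) hz
    have h1 : (y * I - (β + γ * cauchyG m (y * I))) * cauchyG P (y * I) = 1 := by
      rw [← h _ hz, Ftr, inv_mul_cancel₀ hG]
    push_cast
    generalize cauchyG P (y * I) = G at *
    generalize cauchyG m (y * I) = g at *
    have hy2 : (y : ℂ) ^ 2 = -(y * I) ^ 2 := by rw [mul_pow, I_sq]; ring
    rw [hy2, show (β : ℂ) * y * I = β * (y * I) by ring]
    generalize (y : ℂ) * I = z at *
    linear_combination (z ^ 2 + β * z) * h1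

theorem integrable_sq_of_Ftr_eq (hγ : 0 ≤ γ)
    (h : ∀ z ∈ UHP, Ftr P z = z - (β + γ * cauchyG m z)) :
    Integrable (fun x : ℝ => x ^ 2) P ∧ ∫ x : ℝ, x ^ 2 ∂P = β ^ 2 + γ ∧ ∫ x : ℝ, x ∂P = β := by
  obtain ⟨E, hE, hEq⟩ := exists_tendsto_sq_mul_one_sub h
  let y : ℕ → ℝ := fun n => n + 1
  have hy : ∀ n, 0 < y n := fun n => by positivity
  have hyt : Tendsto y atTop atTop :=
    tendsto_atTop_add_const_right _ _ tendsto_natCast_atTop_atTop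
  let k : ℕ → ℝ → ℝ := fun n x => y n ^ 2 / (y n ^ 2 + x ^ 2)
  have hk : ∀ x, Tendsto (fun n => k n x) atTop (𝓝 1) := fun x =>
    (tendsto_sq_div_sq_add x).comp hyt
  have hk0 : ∀ n x, 0 ≤ k n x := fun n x => by positivity
  have hk1 : ∀ n x, k n x ≤ 1 := fun n x =>
    div_le_one_of_le₀ (by nlinarith [sq_nonneg x]) (by positivity)
  have hsq : ∀ n, ∫ x, x ^ 2 * k n x ∂P = (E (y n)).re := fun n => by
    rw [(integral_sq_mul_one_sub (hy n)).2.1, hEq _ (hy n)]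
    simp
  have hid : ∀ n, ∫ x, x * k n x ∂P = β + (E (y n)).im / y n := fun n => by
    have h1 := (integral_sq_mul_one_sub (P := P) (hy n)).2.2
    rw [hEq _ (hy n), add_im, im_ofReal_mul, I_im, mul_one] at h1
    have := (hy n).ne'
    field_simp
    linarith
  have hEn := hE.comp hyt
  have hEre : Tendsto (fun n => (E (y n)).re) atTop (𝓝 (β ^ 2 + γ)) :=
    (continuous_re.tendsto _).comp hEn
  have hEim : Tendsto (fun n => (E (y n)).im) atTop (𝓝 0) := by
    rw [← ofReal_im (β ^ 2 + γ)]
    exact (continuous_im.tendsto _).comp hEn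
  have hlim : Tendsto (fun n => ∫⁻ x, ENNReal.ofReal (x ^ 2 * k n x) ∂P) atTop
      (𝓝 (∫⁻ x, ENNReal.ofReal (x ^ 2) ∂P)) := by
    refine lintegral_tendsto_of_tendsto_of_monotone
      (fun n => Measurable.aemeasurable (by fun_prop)) (ae_of_all _ fun x n n' hn => ?_)
      (ae_of_all _ fun x => ?_)
    · refine ENNReal.ofReal_le_ofReal (mul_le_mul_of_nonneg_left
        (sq_div_sq_add_mono (hy n) ?_ x) (sq_nonneg x))
      have : (n : ℝ) ≤ n' := Nat.cast_le.2 hn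
      simpa [y] using this
    · refine (ENNReal.continuous_ofReal.tendsto _).comp ?_
      simpa using (hk x).const_mul (x ^ 2)
  have hval : ∫⁻ x, ENNReal.ofReal (x ^ 2) ∂P = ENNReal.ofReal (β ^ 2 + γ) := by
    refine tendsto_nhds_unique hlim
      (((ENNReal.continuous_ofReal.tendsto _).comp hEre).congr fun n => ?_)
    rw [Function.comp, ← hsq, ofReal_integral_eq_lintegral_ofReal
      (integral_sq_mul_one_sub (hy n)).1
      (ae_of_all _ fun x => mul_nonneg (sq_nonneg x) (hk0 n x))]
  have hint : Integrable (fun x : ℝ => x ^ 2) P := by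
    refine ⟨Measurable.aestronglyMeasurable (by fun_prop), ?_⟩
    rw [hasFiniteIntegral_iff_ofReal (ae_of_all _ sq_nonneg), hval]
    exact ENNReal.ofReal_lt_top
  refine ⟨hint, ?_, ?_⟩
  · rw [integral_eq_lintegral_of_nonneg_ae (ae_of_all _ sq_nonneg) hint.1, hval,
      ENNReal.toReal_ofReal (by positivity)]
  · have h1 : Tendsto (fun n => ∫ x, x * k n x ∂P) atTop (𝓝 (∫ x, x ∂P)) := by
      refine tendsto_integral_of_dominated_convergence (fun x => 1 + x ^ 2)
        (fun n => Measurable.aestronglyMeasurable (by fun_prop))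
        ((integrable_const _).add hint) (fun n => ae_of_all _ fun x => ?_)
        (ae_of_all _ fun x => by simpa using (hk x).const_mul x)
      rw [norm_mul, Real.norm_of_nonneg (hk0 n x), Real.norm_eq_abs]
      refine (mul_le_of_le_one_right (abs_nonneg x) (hk1 n x)).trans ?_
      nlinarith [sq_abs x, sq_nonneg (|x| - 1)]
    have h2 := (hEim.div_atTop hyt).const_add β
    rw [add_zero] at h2
    exact tendsto_nhds_unique h1 (h2.congr fun n => (hid n).symm)

lemma variance_of_Ftr_eq (hγ : 0 ≤ γ) (h : ∀ z ∈ UHP, Ftr P z = z - (β + γ * cauchyG m z)) :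
    ProbabilityTheory.variance (fun x : ℝ => x) P = γ := by
  obtain ⟨h2, hsq, hid⟩ := integrable_sq_of_Ftr_eq hγ h
  have hL : MemLp (fun x : ℝ => x) 2 P :=
    (memLp_two_iff_integrable_sq measurable_id.aestronglyMeasurable).2 h2
  rw [ProbabilityTheory.variance_eq_sub hL, hid]
  simp only [Pi.pow_apply, hsq]
  ring

end Moments

section Semigroup

variable {μ ρ ν : Measure ℝ} {φ φρ φτ : ℂ → ℂ}

lemma eventually_coneAtTop_mono {α α' : ℝ} (h : α ≤ α') {p : ℂ → Prop}
    (hp : ∀ᶠ z in coneAtTop α', p z) : ∀ᶠ z in coneAtTop α, p z := by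
  obtain ⟨M, hM, hp⟩ := eventually_coneAtTop.1 hp
  refine eventually_coneAtTop.2 ⟨M, hM, fun z hz => hp z ⟨hz.1.trans_le ?_, hz.2⟩⟩
  exact mul_le_mul_of_nonneg_right h (hM.trans hz.2).le

/-- A Voiculescu transform of a subordination distribution. -/
lemma isVT_subordination [IsProbabilityMeasure μ] (hρ : IsVT ρ φρ)
    (hν : IsVT ν fun z => φτ z + φρ z)
    (h : ∀ z ∈ UHP, Ftr ν z = Ftr ρ (Ftr μ z)) : IsVT μ fun z => φτ (Ftr ρ z) := by
  obtain ⟨α₁, hα₁, h₁⟩ := isVT_iff.1 hρ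
  obtain ⟨α₂, hα₂, h₂⟩ := isVT_iff.1 hν
  have hα : 0 < min (α₁ / 2) α₂ := by positivity
  refine isVT_iff.2 ⟨min (α₁ / 2) α₂, hα, ?_⟩
  have hlt : min (α₁ / 2) α₂ < α₁ := (min_le_left _ _).trans_lt (half_lt_self hα₁)
  filter_upwards [eventually_coneAtTop_mono (min_le_right _ _) h₂,
    (tendsto_Ftr_coneAtTop μ hα hlt).eventually h₁, eventually_im_pos_coneAtTop _] with z h2 h1 hz
  rw [h z hz] at h2
  linear_combination h2 - h1

/-- If `ω = F_μ` solves `F_ν(z + F_ρ(ω) - ω) = F_ρ(ω)` and `φ` is a Voiculescu transform of `ν`,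
then `φ ∘ F_ρ` is a Voiculescu transform of `μ`. -/
lemma isVT_of_Ftr_add_eq [IsProbabilityMeasure μ] [IsProbabilityMeasure ρ] (hν : IsVT ν φ)
    (h : ∀ z ∈ UHP, Ftr ν (z + (Ftr ρ (Ftr μ z) - Ftr μ z)) = Ftr ρ (Ftr μ z)) :
    IsVT μ fun z => φ (Ftr ρ z) := by
  obtain ⟨α, hα, h₁⟩ := isVT_iff.1 hν
  refine isVT_iff.2 ⟨α / 2, half_pos hα, ?_⟩
  filter_upwards [(tendsto_add_Ftr_comp_sub_coneAtTop μ ρ (half_pos hα)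
    (half_lt_self hα)).eventually h₁, eventually_im_pos_coneAtTop _] with z h1 hz
  rw [h z hz] at h1
  linear_combination h1

lemma isVT_add_of_Ftr_eq_comp [IsProbabilityMeasure μ] (hρ : IsVT ρ φρ)
    (hμ : IsVT μ fun z => φ (Ftr ρ z)) (h : ∀ z ∈ UHP, Ftr ν z = Ftr ρ (Ftr μ z)) :
    IsVT ν fun z => φρ z + φ z := by
  obtain ⟨α₁, hα₁, h₁⟩ := isVT_iff.1 hρ
  obtain ⟨α₂, hα₂, h₂⟩ := isVT_iff.1 hμ
  have hα : 0 < min (α₁ / 2) α₂ := by positivity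
  refine isVT_iff.2 ⟨min (α₁ / 2) α₂, hα, ?_⟩
  have hlt : min (α₁ / 2) α₂ < α₁ := (min_le_left _ _).trans_lt (half_lt_self hα₁)
  filter_upwards [eventually_coneAtTop_mono (min_le_right _ _) h₂,
    (tendsto_Ftr_coneAtTop μ hα hlt).eventually h₁, eventually_im_pos_coneAtTop _] with z h2 h1 hz
  rw [h z hz]
  linear_combination h2 + h1

end Semigroup

end FreeConvolution

/-- For any probability measure `tρ`, any ⊞-infinitely divisible `τ`
(with powers `τpow`, subordination distribution `sub = τ ⊳ tρ`), and any `tβ ∈ ℝ`, `tγ > 0`,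
there is a two-state free convolution semigroup `{(tμ t, μ t)}` with `μ t = (τ ⊳ tρ)^{⊞t}`,
`tμ 1` of mean `tβ` and variance `tγ`, and `J[tμ t] = tρ ⊞ τ^{⊞t}` for `t > 0`, where `tμ t`
is defined by `z − F_{tμ_t}(z) = tβ·t + tγ·t·G_{tρ ⊞ τ^{⊞t}}(z)`. -/
theorem stmt9
    (tβ tγ : ℝ) (htγ : 0 < tγ)
    (tρ τ : Measure ℝ) (htρ : IsProbabilityMeasure tρ) (hτ : IsProbabilityMeasure τ)
    (φτ φρ : ℂ → ℂ) (hφτ : IsVT τ φτ) (hφρ : IsVT tρ φρ)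
    (τpow : ℝ → Measure ℝ) (hτp : ∀ t : ℝ, 0 ≤ t → IsProbabilityMeasure (τpow t))
    (hτpVT : ∀ t : ℝ, 0 ≤ t → IsVT (τpow t) (fun z => (t : ℂ) * φτ z))
    (conv : Measure ℝ) (hconvprob : IsProbabilityMeasure conv)
    (hconv : IsVT conv (fun z => φτ z + φρ z))
    (sub : Measure ℝ) (hsubprob : IsProbabilityMeasure sub)
    (hsub : ∀ z ∈ UHP, cauchyG conv z = cauchyG tρ (Ftr sub z)) :
    ∃ μ tμ : ℝ → Measure ℝ,
      (∀ t : ℝ, 0 ≤ t → IsProbabilityMeasure (μ t) ∧ IsProbabilityMeasure (tμ t)) ∧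
      (∃ φs : ℂ → ℂ, IsVT sub φs ∧
        ∀ t : ℝ, 0 ≤ t → IsVT (μ t) (fun z => (t : ℂ) * φs z)) ∧
      (∃ ψ : ℂ → ℂ, ∀ t : ℝ, 0 ≤ t →
        IsTwoStateVT (tμ t) (μ t) (fun z => (t : ℂ) * ψ z)) ∧
      Integrable (fun x : ℝ => x ^ 2) (tμ 1) ∧
      (∫ x : ℝ, x ∂(tμ 1)) = tβ ∧
      ProbabilityTheory.variance (fun x : ℝ => x) (tμ 1) = tγ ∧
      (∀ t : ℝ, 0 ≤ t → ∃ m : Measure ℝ, IsProbabilityMeasure m ∧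
        IsVT m (fun z => φρ z + (t : ℂ) * φτ z) ∧
        ∀ z ∈ UHP, z - Ftr (tμ t) z =
          ((tβ * t : ℝ) : ℂ) + ((tγ * t : ℝ) : ℂ) * cauchyG m z) := by
  have key : ∀ t : ℝ, ∃ μ m P : Measure ℝ, 0 ≤ t →
      IsProbabilityMeasure μ ∧ IsProbabilityMeasure m ∧ IsProbabilityMeasure P ∧
      (∀ z ∈ UHP, Ftr (τpow t) (z + (Ftr tρ (Ftr μ z) - Ftr μ z)) = Ftr tρ (Ftr μ z)) ∧
      (∀ z ∈ UHP, Ftr m z = Ftr tρ (Ftr μ z)) ∧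
      ∀ z ∈ UHP, Ftr P z = z - (((tβ * t : ℝ) : ℂ) + ((tγ * t : ℝ) : ℂ) * cauchyG m z) := by
    intro t
    by_cases ht : 0 ≤ t
    · have := hτp t ht
      obtain ⟨μ, hμ, hω⟩ := exists_subordination tρ (τpow t)
      obtain ⟨m, hm, hmF⟩ := exists_Ftr_eq_comp μ tρ
      obtain ⟨P, hP, hPF⟩ := exists_Ftr_eq_sub_cauchyG m (tβ * t) (mul_nonneg htγ.le ht)
      exact ⟨μ, m, P, fun _ => ⟨hμ, hm, hP, hω, hmF, hPF⟩⟩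
    · exact ⟨0, 0, 0, fun h => absurd h ht⟩
  choose μ m P h using key
  have hμVT : ∀ t : ℝ, 0 ≤ t → IsVT (μ t) (fun z => (t : ℂ) * φτ (Ftr tρ z)) := fun t ht => by
    obtain ⟨_, -, -, hω, -⟩ := h t ht
    exact isVT_of_Ftr_add_eq (hτpVT t ht) hω
  have hP1 := h 1 zero_le_one
  simp only [mul_one] at hP1
  obtain ⟨_, hm1, hP1, -, -, hPF1⟩ := hP1
  obtain ⟨hint, -, hmean⟩ := integrable_sq_of_Ftr_eq htγ.le hPF1
  refine ⟨μ, P, fun t ht => ⟨(h t ht).1, (h t ht).2.2.1⟩,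
    ⟨fun z => φτ (Ftr tρ z), ?_, hμVT⟩, ⟨fun z => tβ + tγ * cauchyG tρ z, fun t ht => ?_⟩,
    hint, hmean, variance_of_Ftr_eq htγ.le hPF1, fun t ht => ?_⟩
  · exact isVT_subordination hφρ hconv fun z hz => congrArg (·⁻¹) (hsub z hz)
  · obtain ⟨_, -, -, -, hmF, hPF⟩ := h t ht
    refine ⟨1, 1, one_pos, one_pos, fun z hz => ?_⟩
    have hzU : z ∈ UHP := one_pos.trans hz.2
    have hG : cauchyG (m t) z = cauchyG tρ (Ftr (μ t) z) := inv_injective (hmF z hzU)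
    rw [hPF z hzU, hG]
    push_cast
    ring
  · obtain ⟨_, hm, -, -, hmF, hPF⟩ := h t ht
    refine ⟨m t, hm, isVT_add_of_Ftr_eq_comp hφρ (hμVT t ht) hmF, fun z hz => ?_⟩
    rw [hPF z hz, sub_sub_cancel]
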